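/- arXiv:2504.05633 — 2 statements merged into one kernel-verified Lean document; each statement's English description precedes it below -/
import Mathlib

section
/- Let T, β, A, M₂ be positive real constants and define f : ℝ → ℝ by f(r₂) = (T² − 2Tβ·√(A·log(M₂·r₂ + 1)·r₂) + 2Aβ²·log(M₂·r₂ + 1)·r₂) / (Aβ²). If r* ∈ [0,1] is a maximizer of f over the interval [0,1], then r* = 0, or r* = 1, or β·√(A·log(M₂·r* + 1)·r*) = T/2 (i.e., exactly half of the total delivery resources T are allocated to region 2). In other words, in the steady state it is optimal either to invest all delivery resources in one region or to allocate resources equally to the two regions. -/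
/-- Theorem 1: a maximizer of the substituted steady-state objective over [0,1]
is either 0, 1, or allocates exactly half of the resources to region 2. -/
theorem steady_state_optimal_allocation
    (T β A M₂ : ℝ) (hT : 0 < T) (hβ : 0 < β) (hA : 0 < A) (hM₂ : 0 < M₂)
    (f : ℝ → ℝ)
    (hf : ∀ r₂ : ℝ, f r₂ =
      (T ^ 2 - 2 * T * β * Real.sqrt (A * Real.log (M₂ * r₂ + 1) * r₂)
        + 2 * A * β ^ 2 * Real.log (M₂ * r₂ + 1) * r₂) / (A * β ^ 2))
    (r : ℝ) (hr : r ∈ Set.Icc (0 : ℝ) 1)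
    (hmax : ∀ s ∈ Set.Icc (0 : ℝ) 1, f s ≤ f r) :
    r = 0 ∨ r = 1 ∨ β * Real.sqrt (A * Real.log (M₂ * r + 1) * r) = T / 2 := by
  obtain ⟨h0, h1⟩ := hr
  rcases h0.eq_or_lt with h | hpos
  · exact Or.inl h.symm
  rcases h1.eq_or_lt with h | hlt
  · exact Or.inr (Or.inl h)
  exfalso
  have hlog : 0 < Real.log (M₂ * r + 1) := Real.log_pos (by nlinarith)
  have hlog_lt : Real.log (M₂ * r + 1) < Real.log (M₂ * 1 + 1) :=
    Real.log_lt_log (by positivity) (by nlinarith)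
  have hprod : Real.log (M₂ * r + 1) * r < Real.log (M₂ * 1 + 1) * 1 := by nlinarith
  have hden : 0 < A * β ^ 2 := by positivity
  have hf_eq : ∀ s, 0 ≤ A * Real.log (M₂ * s + 1) * s →
      f s = (T ^ 2 - 2 * T * (β * Real.sqrt (A * Real.log (M₂ * s + 1) * s))
        + 2 * (β * Real.sqrt (A * Real.log (M₂ * s + 1) * s)) ^ 2) / (A * β ^ 2) := by
    intro s hs
    rw [hf, mul_pow, Real.sq_sqrt hs]
    ring
  have hu : 0 < β * Real.sqrt (A * Real.log (M₂ * r + 1) * r) := by positivity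
  have huv : β * Real.sqrt (A * Real.log (M₂ * r + 1) * r)
      < β * Real.sqrt (A * Real.log (M₂ * 1 + 1) * 1) :=
    mul_lt_mul_of_pos_left (Real.sqrt_lt_sqrt (by positivity) (by nlinarith)) hβ
  have hmax0 := hmax 0 (by simp)
  have hmax1 := hmax 1 (by simp)
  rw [hf_eq r (by positivity), hf_eq 0 (by simp), div_le_div_iff_of_pos_right hden,
    mul_zero, Real.sqrt_zero, mul_zero] at hmax0
  rw [hf_eq r (by positivity), hf_eq 1 (by nlinarith), div_le_div_iff_of_pos_right hden] at hmax1
  generalize β * Real.sqrt (A * Real.log (M₂ * r + 1) * r) = u at *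
  generalize β * Real.sqrt (A * Real.log (M₂ * 1 + 1) * 1) = v at *
  have hTu : T ≤ u := by
    by_contra! h
    nlinarith [mul_pos hu (sub_pos.mpr h)]
  nlinarith [mul_pos (sub_pos.mpr huv) (show 0 < u + v - T by linarith)]
end

section
/- Let T, β, A, M₂ be positive real constants and define f : ℝ → ℝ by f(r₂) = (T² − 2Tβ·√(A·log(M₂·r₂ + 1)·r₂) + 2Aβ²·log(M₂·r₂ + 1)·r₂) / (Aβ²). For every r₂ in the open interval (0,1), the derivative of f at r₂ equals zero if and only if β·√(A·log(M₂·r₂ + 1)·r₂) = T/2, i.e., a critical point of f occurs exactly when half of the total delivery resources T are allocated to region 2. -/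
/-- If `g` is positive at `x`, the derivative at `x` of the quadratic
`T² - 2Tβ√g + 2β²g` in `β√g`, divided by `c`, in factored form. -/
theorem HasDerivAt.quadratic_sqrt_div {g : ℝ → ℝ} {g' x : ℝ} (hg : HasDerivAt g g' x)
    (hx : 0 < g x) (T β c : ℝ) :
    HasDerivAt (fun y => (T ^ 2 - 2 * T * β * √(g y) + 2 * β ^ 2 * g y) / c)
      (β * g' / (√(g x) * c) * (2 * (β * √(g x)) - T)) x := by
  have hs : √(g x) ≠ 0 := (Real.sqrt_pos.2 hx).ne'
  refine HasDerivAt.congr_deriv (((((hg.sqrt hx.ne').const_mul (2 * T * β)).const_sub (T ^ 2)).add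
    (hg.const_mul (2 * β ^ 2))).div_const c) ?_
  by_cases hc : c = 0
  · simp [hc]
  · field_simp
    ring

/-- Lemma 1: on (0,1) the derivative of the substituted steady-state objective
vanishes exactly when half of the total resources are allocated to region 2. -/
theorem critical_point_iff_half_allocation
    (T β A M₂ : ℝ) (hT : 0 < T) (hβ : 0 < β) (hA : 0 < A) (hM₂ : 0 < M₂)
    (f : ℝ → ℝ)
    (hf : ∀ r₂ : ℝ, f r₂ =
      (T ^ 2 - 2 * T * β * Real.sqrt (A * Real.log (M₂ * r₂ + 1) * r₂)
        + 2 * A * β ^ 2 * Real.log (M₂ * r₂ + 1) * r₂) / (A * β ^ 2))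
    (r₂ : ℝ) (hr₂ : r₂ ∈ Set.Ioo (0 : ℝ) 1) :
    deriv f r₂ = 0 ↔
      β * Real.sqrt (A * Real.log (M₂ * r₂ + 1) * r₂) = T / 2 := by
  obtain ⟨hr, -⟩ := hr₂
  have hMr : 0 < M₂ * r₂ := mul_pos hM₂ hr
  have hlog : 0 < Real.log (M₂ * r₂ + 1) := Real.log_pos (by linarith)
  have hpos : 0 < A * Real.log (M₂ * r₂ + 1) * r₂ := by positivity
  have hlin : HasDerivAt (fun y : ℝ => M₂ * y + 1) M₂ r₂ := by
    simpa using ((hasDerivAt_id r₂).const_mul M₂).add_const 1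
  have hg : HasDerivAt (fun y : ℝ => A * Real.log (M₂ * y + 1) * y)
      (A * (M₂ / (M₂ * r₂ + 1)) * r₂ + A * Real.log (M₂ * r₂ + 1) * 1) r₂ :=
    ((hlin.log (by positivity)).const_mul A).mul (hasDerivAt_id r₂)
  have hfg : f = fun y => (T ^ 2 - 2 * T * β * √(A * Real.log (M₂ * y + 1) * y)
      + 2 * β ^ 2 * (A * Real.log (M₂ * y + 1) * y)) / (A * β ^ 2) := by
    funext y
    rw [hf]
    ring
  have hs := Real.sqrt_pos.2 hpos
  rw [hfg, (hg.quadratic_sqrt_div hpos T β (A * β ^ 2)).deriv, mul_eq_zero_iff_left (by positivity)]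
  constructor <;> intro h <;> linarith
end
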